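/- For every a ∈ ℂ with a ≠ 0 and every q ∈ ℤ≥0, the reduced cohomology of the Schrödinger-Virasoro conformal algebra with coefficients in the trivial module ℂ_a vanishes: H^q(SV,ℂ_a) = 0. -/

import Mathlib

/-!
Cochain complex of the Schrödinger–Virasoro conformal algebra
`SV = ℂ[∂]L ⊕ ℂ[∂]Y ⊕ ℂ[∂]M` with coefficients in the trivial module `ℂ_a`.

Since `SV` is a free `ℂ[∂]`-module on the generators `L, Y, M`, and since a
`q`-cochain (a `ℂ`-linear, conformally antilinear map `SV^{⊗q} → ℂ[λ₁,…,λ_q]`)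
is uniquely determined by its values on `q`-tuples of generators, we model
cochains as functions from generator tuples to `ℂ[λ₁,…,λ_q]`, subject to the
skew-symmetry condition (simultaneous permutation of the entries and the
variables `λᵢ`).
-/

namespace SVCA

open MvPolynomial

/-- The generators `L`, `Y`, `M` of the Schrödinger–Virasoro conformal algebra. -/
inductive SVGen : Type
  | L | Y | M
  deriving DecidableEq

open SVGen

/-- The λ-brackets on generators: `SVbrk a b = (x, c₁, c₂)` encodes
`[a_λ b] = (c₁ ∂ + c₂ λ) x`.  Zero brackets are encoded by zero coefficients:
`[L_λ L] = (∂+2λ)L`, `[L_λ Y] = (∂+(3/2)λ)Y`, `[Y_λ L] = ((1/2)∂+(3/2)λ)Y`,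
`[Y_λ Y] = (∂+2λ)M`, `[L_λ M] = (∂+λ)M`, `[M_λ L] = λM`, and
`[Y_λ M] = [M_λ Y] = [M_λ M] = 0`. -/
noncomputable def SVbrk : SVGen → SVGen → SVGen × ℂ × ℂ
  | L, L => (L, 1, 2)
  | L, Y => (Y, 1, 3/2)
  | Y, L => (Y, 1/2, 3/2)
  | Y, Y => (M, 1, 2)
  | L, M => (M, 1, 1)
  | M, L => (M, 0, 1)
  | _, _ => (M, 0, 0)

/-- The space of (not necessarily skew-symmetric) `q`-cochains with trivial
coefficients: functions from `q`-tuples of generators to `ℂ[λ₁,…,λ_q]`. -/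
abbrev SVRaw (q : ℕ) := (Fin q → SVGen) → MvPolynomial (Fin q) ℂ

/-- The `ℂ`-subspace `C̃^q(SV,ℂ)` of `q`-cochains: skew-symmetry with respect to
simultaneous permutations of the arguments and of the variables `λᵢ`. -/
noncomputable def SVCochain (q : ℕ) : Submodule ℂ (SVRaw q) where
  carrier := {c | ∀ (σ : Equiv.Perm (Fin q)) (a : Fin q → SVGen),
      rename σ (c (a ∘ σ)) = ((Equiv.Perm.sign σ : ℤ) : ℂ) • c a}
  add_mem' := by
    intro c c' hc hc' σ a
    simp only [Pi.add_apply, map_add, hc σ a, hc' σ a, smul_add]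
  zero_mem' := by intro σ a; simp
  smul_mem' := by
    intro r c hc σ a
    simp only [Pi.smul_apply, map_smul, hc σ a]
    rw [smul_comm]

/-- The strictly increasing embedding `Fin q → Fin (q+2)` omitting `i` and `j`
(meaningful for `i < j`; junk otherwise). -/
def SVskip {q : ℕ} (i j : Fin (q + 2)) (k : Fin q) : Fin (q + 2) :=
  j.succAbove ((⟨min (i : ℕ) q, Nat.lt_succ_of_le (Nat.min_le_right _ _)⟩ : Fin (q + 1)).succAbove k)

/-- The `(i,j)`-summand of the differential (trivial coefficients):
`(-1)^{i+j} γ_{λᵢ+λⱼ, λ₁, …, λ̂ᵢ, …, λ̂ⱼ, …}([a_{i λᵢ} a_j], a₁, …, âᵢ, …, âⱼ, …)`,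
where `[a_{i λᵢ} a_j] = (c₁∂ + c₂λᵢ)x` and conformal antilinearity in the first
slot (whose variable is `λᵢ+λⱼ`) produces the factor `c₂λᵢ - c₁(λᵢ+λⱼ)`. -/
noncomputable def SVdTerm {q : ℕ} (c : SVRaw (q + 1)) (a : Fin (q + 2) → SVGen)
    (i j : Fin (q + 2)) : MvPolynomial (Fin (q + 2)) ℂ :=
  ((-1 : ℂ) ^ ((i : ℕ) + (j : ℕ))) •
    ((C (SVbrk (a i) (a j)).2.2 * X i - C (SVbrk (a i) (a j)).2.1 * (X i + X j)) *
      aeval (Fin.cons (X i + X j) fun k => X (SVskip i j k))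
        (c (Fin.cons (SVbrk (a i) (a j)).1 fun k => a (SVskip i j k))))

/-- The differential `d_q : C̃^q → C̃^{q+1}` (trivial coefficients). -/
noncomputable def SVd : {q : ℕ} → SVRaw q → SVRaw (q + 1)
  | 0, _ => 0
  | (q + 1), c => fun a =>
      ∑ i : Fin (q + 2), ∑ j : Fin (q + 2),
        if (i : ℕ) < (j : ℕ) then SVdTerm c a i j else 0

lemma SVdTerm_add {q : ℕ} (c c' : SVRaw (q + 1)) (a : Fin (q + 2) → SVGen)
    (i j : Fin (q + 2)) :
    SVdTerm (c + c') a i j = SVdTerm c a i j + SVdTerm c' a i j := by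
  simp [SVdTerm, mul_add, smul_add]

lemma SVdTerm_smul {q : ℕ} (r : ℂ) (c : SVRaw (q + 1)) (a : Fin (q + 2) → SVGen)
    (i j : Fin (q + 2)) :
    SVdTerm (r • c) a i j = r • SVdTerm c a i j := by
  simp only [SVdTerm, Pi.smul_apply, map_smul, mul_smul_comm]
  rw [smul_comm]

/-- The differential as a `ℂ`-linear map. -/
noncomputable def SVdLin (q : ℕ) : SVRaw q →ₗ[ℂ] SVRaw (q + 1) where
  toFun := SVd
  map_add' c c' := by
    cases q with
    | zero => simp [SVd]
    | succ q =>
      funext a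
      simp only [SVd, Pi.add_apply]
      rw [← Finset.sum_add_distrib]
      refine Finset.sum_congr rfl fun i _ => ?_
      rw [← Finset.sum_add_distrib]
      refine Finset.sum_congr rfl fun j _ => ?_
      by_cases h : (i : ℕ) < (j : ℕ)
      · simp [h, SVdTerm_add]
      · simp [h]
  map_smul' r c := by
    cases q with
    | zero => simp [SVd]
    | succ q =>
      funext a
      simp only [SVd, RingHom.id_apply, Pi.smul_apply, Finset.smul_sum]
      refine Finset.sum_congr rfl fun i _ => ?_
      refine Finset.sum_congr rfl fun j _ => ?_
      by_cases h : (i : ℕ) < (j : ℕ)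
      · simp [h, SVdTerm_smul]
      · simp [h]

/-- The space `D̃^q(SV,ℂ)` of `q`-cocycles: skew-symmetric cochains with `dγ = 0`. -/
noncomputable def SVcocycles (q : ℕ) : Submodule ℂ (SVRaw q) :=
  SVCochain q ⊓ LinearMap.ker (SVdLin q)

/-- The space `B̃^q(SV,ℂ)` of `q`-coboundaries: differentials of `(q-1)`-cochains
(`0` for `q = 0`). -/
noncomputable def SVcoboundaries : (q : ℕ) → Submodule ℂ (SVRaw q)
  | 0 => ⊥
  | (q + 1) => Submodule.map (SVdLin q) (SVCochain q)

/-- The basic cohomology `H̃^q(SV,ℂ)` = cocycles / coboundaries. -/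
noncomputable def SVbasicH (q : ℕ) :=
  SVcocycles q ⧸ Submodule.comap (SVcocycles q).subtype (SVcoboundaries q)


noncomputable instance (q : ℕ) : AddCommGroup (SVbasicH q) := by
  unfold SVbasicH; infer_instance
noncomputable instance (q : ℕ) : Module ℂ (SVbasicH q) := by
  unfold SVbasicH; infer_instance

/-- The action of `∂` on `q`-cochains with coefficients in `ℂ_a`:
`(∂γ)_{λ₁,…,λ_q} = (a + λ₁ + ⋯ + λ_q)·γ_{λ₁,…,λ_q}`.  (The trivial module `ℂ`
is the case `a = 0`.) -/
noncomputable def SVpartial (a : ℂ) (q : ℕ) : SVRaw q →ₗ[ℂ] SVRaw q where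
  toFun c := fun t => (C a + ∑ i, X i) * c t
  map_add' c c' := by funext t; simp [mul_add]
  map_smul' r c := by funext t; simp [mul_smul_comm]

/-- The subspace `∂C̃^q ⊆ C̃^q` (with coefficients in `ℂ_a`). -/
noncomputable def SVpartialSub (a : ℂ) (q : ℕ) : Submodule ℂ (SVRaw q) :=
  Submodule.map (SVpartial a q) (SVCochain q)

/-- `q`-cochains representing reduced `q`-cocycles: cochains `γ` with
`dγ ∈ ∂C̃^{q+1}` (these are exactly the representatives of `ker d̄`
in the quotient complex `C̃^•/∂C̃^•`). -/
noncomputable def SVredCocycles (a : ℂ) (q : ℕ) : Submodule ℂ (SVRaw q) :=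
  SVCochain q ⊓ Submodule.comap (SVdLin q) (SVpartialSub a (q + 1))

/-- `q`-cochains representing reduced `q`-coboundaries: `∂C̃^q + dC̃^{q-1}`
(these are exactly the representatives of `im d̄` in the quotient complex). -/
noncomputable def SVredCoboundaries (a : ℂ) : (q : ℕ) → Submodule ℂ (SVRaw q)
  | 0 => SVpartialSub a 0
  | (q + 1) => SVpartialSub a (q + 1) ⊔ Submodule.map (SVdLin q) (SVCochain q)

/-- The reduced cohomology `H^q(SV,ℂ_a)`, realized (via the third isomorphism
theorem) as `{γ ∈ C̃^q : dγ ∈ ∂C̃^{q+1}} / (∂C̃^q + dC̃^{q-1})`. -/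
noncomputable def SVredH (a : ℂ) (q : ℕ) :=
  SVredCocycles a q ⧸ Submodule.comap (SVredCocycles a q).subtype (SVredCoboundaries a q)


noncomputable instance (a : ℂ) (q : ℕ) : AddCommGroup (SVredH a q) := by
  unfold SVredH; infer_instance
noncomputable instance (a : ℂ) (q : ℕ) : Module ℂ (SVredH a q) := by
  unfold SVredH; infer_instance

/-- The cocycles of the subcomplex `∂C̃^•` (trivial coefficients `ℂ`). -/
noncomputable def SVsubCocycles (q : ℕ) : Submodule ℂ (SVRaw q) :=
  SVpartialSub 0 q ⊓ LinearMap.ker (SVdLin q)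

/-- The coboundaries of the subcomplex `∂C̃^•` (trivial coefficients `ℂ`). -/
noncomputable def SVsubCoboundaries : (q : ℕ) → Submodule ℂ (SVRaw q)
  | 0 => ⊥
  | (q + 1) => Submodule.map (SVdLin q) (SVpartialSub 0 q)

/-- The cohomology `H^q(∂C̃^•)` of the subcomplex `∂C̃^•` (trivial coefficients). -/
noncomputable def SVsubH (q : ℕ) :=
  SVsubCocycles q ⧸ Submodule.comap (SVsubCocycles q).subtype (SVsubCoboundaries q)


noncomputable instance (q : ℕ) : AddCommGroup (SVsubH q) := by
  unfold SVsubH; infer_instance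
noncomputable instance (q : ℕ) : Module ℂ (SVsubH q) := by
  unfold SVsubH; infer_instance

/-- The operator `τ`:
`(τγ)_{λ₁,…,λ_{q-1}}(a₁,…,a_{q-1}) = (-1)^{q-1} ∂/∂λ γ_{λ₁,…,λ_{q-1},λ}(a₁,…,a_{q-1},L)|_{λ=0}`. -/
noncomputable def SVtau {q : ℕ} (c : SVRaw (q + 1)) : SVRaw q := fun a =>
  ((-1 : ℂ) ^ q) •
    aeval (Fin.snoc (fun i : Fin q => X i) 0)
      (pderiv (Fin.last q) (c (Fin.snoc a SVGen.L)))

/-- The operator `τ₂`: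
`(τ₂γ)_{λ₁,…,λ_{q-1}}(a₁,…,a_{q-1}) = (-1)^{q-1} γ_{λ₁,…,λ_{q-1},λ}(a₁,…,a_{q-1},L)|_{λ=0}`. -/
noncomputable def SVtau2 {q : ℕ} (c : SVRaw (q + 1)) : SVRaw q := fun a =>
  ((-1 : ℂ) ^ q) • aeval (Fin.snoc (fun i : Fin q => X i) 0) (c (Fin.snoc a SVGen.L))

/-- The tuple with `k` copies of `L`, then `l` copies of `Y`, then copies of `M`. -/
def SVtuple (q k l : ℕ) : Fin q → SVGen := fun i =>
  if (i : ℕ) < k then SVGen.L else if (i : ℕ) < k + l then SVGen.Y else SVGen.M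

/-- `∏_{i<j ∈ s} (λᵢ - λⱼ)`. -/
noncomputable def SVvandermonde (q : ℕ) (s : Finset (Fin q)) : MvPolynomial (Fin q) ℂ :=
  ∏ p ∈ (s ×ˢ s).filter fun p => p.1 < p.2, (X p.1 - X p.2)

/-- Skew-symmetry of a cochain, after substituting elements of a commutative algebra for the
variables. -/
lemma SVCochain.aeval_comp {q : ℕ} {c : SVRaw q} (hc : c ∈ SVCochain q) {A : Type*} [CommRing A]
    [Algebra ℂ A] (σ : Equiv.Perm (Fin q)) (a : Fin q → SVGen) (f : Fin q → A) :
    aeval (f ∘ σ) (c (a ∘ σ)) = ((Equiv.Perm.sign σ : ℤ) : ℂ) • aeval f (c a) := by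
  rw [← map_smul, ← hc σ a, aeval_rename]

lemma cons_succAbove_eq_comp_cycleRange_symm {q : ℕ} {B : Type*} (g : Fin (q + 1) → B)
    (k : Fin (q + 1)) :
    (Fin.cons (g k) fun i => g (k.succAbove i) : Fin (q + 1) → B) = g ∘ k.cycleRange.symm := by
  funext i
  cases i using Fin.cases <;> simp

lemma SVCochain.aeval_cons_succAbove {q : ℕ} {c : SVRaw (q + 1)} (hc : c ∈ SVCochain (q + 1))
    {A : Type*} [CommRing A] [Algebra ℂ A] (k : Fin (q + 1)) (a : Fin (q + 1) → SVGen)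
    (f : Fin (q + 1) → A) :
    aeval (Fin.cons (f k) fun i => f (k.succAbove i) : Fin (q + 1) → A)
        (c (Fin.cons (a k) fun i => a (k.succAbove i))) =
      (-1 : ℂ) ^ (k : ℕ) • aeval f (c a) := by
  rw [cons_succAbove_eq_comp_cycleRange_symm f, cons_succAbove_eq_comp_cycleRange_symm a, SVCochain.aeval_comp hc]
  simp [Equiv.Perm.sign_symm, Fin.sign_cycleRange]

lemma cons_cons_eq_comp_swap {q : ℕ} {B : Type*} (s t : B) (g : Fin q → B) :
    (Fin.cons s (Fin.cons t g : Fin (q + 1) → B) : Fin (q + 2) → B) =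
      (Fin.cons t (Fin.cons s g : Fin (q + 1) → B) : Fin (q + 2) → B) ∘ Equiv.swap 0 1 := by
  funext i
  cases i using Fin.cases with
  | zero => simp
  | succ i =>
    cases i using Fin.cases with
    | zero => simp
    | succ i =>
      rw [Function.comp_apply, Equiv.swap_apply_of_ne_of_ne (Fin.succ_ne_zero _)
        (by simp [Fin.ext_iff])]
      simp

lemma SVCochain.aeval_cons_cons {q : ℕ} {c : SVRaw (q + 2)} (hc : c ∈ SVCochain (q + 2))
    {A : Type*} [CommRing A] [Algebra ℂ A] (x y : SVGen) (a : Fin q → SVGen) (u v : A)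
    (f : Fin q → A) :
    aeval (Fin.cons u (Fin.cons v f) : Fin (q + 2) → A)
        (c (Fin.cons x (Fin.cons y a : Fin (q + 1) → SVGen))) =
      -aeval (Fin.cons v (Fin.cons u f) : Fin (q + 2) → A)
        (c (Fin.cons y (Fin.cons x a : Fin (q + 1) → SVGen))) := by
  rw [cons_cons_eq_comp_swap u v f, cons_cons_eq_comp_swap x y a,
    SVCochain.aeval_comp hc, Equiv.Perm.sign_swap (by simp)]
  simp

/-- Insertion of `L` with `λ = 0` in the first slot of a cochain. -/
noncomputable def SVinsert {q : ℕ} (c : SVRaw (q + 1)) : SVRaw q := fun a =>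
  aeval (Fin.cons 0 X : Fin (q + 1) → MvPolynomial (Fin q) ℂ) (c (Fin.cons L a))

lemma aeval_SVinsert {q : ℕ} (c : SVRaw (q + 1)) {A : Type*} [CommRing A] [Algebra ℂ A]
    (a : Fin q → SVGen) (f : Fin q → A) :
    aeval f (SVinsert c a) = aeval (Fin.cons 0 f : Fin (q + 1) → A) (c (Fin.cons L a)) := by
  rw [SVinsert, ← AlgHom.comp_apply, comp_aeval]
  congr 2
  funext i
  cases i using Fin.cases <;> simp

lemma SVinsert_mem {q : ℕ} {c : SVRaw (q + 1)} (hc : c ∈ SVCochain (q + 1)) :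
    SVinsert c ∈ SVCochain q := by
  intro σ a
  have key {B : Type} (s : B) (g : Fin q → B) :
      (Fin.cons s (g ∘ σ) : Fin (q + 1) → B) =
        (Fin.cons s g : Fin (q + 1) → B) ∘ Equiv.Perm.decomposeFin.symm (0, σ) := by
    funext i
    cases i using Fin.cases <;> simp
  change rename σ (SVinsert c (a ∘ σ)) = _ • SVinsert c a
  rw [show rename σ (SVinsert c (a ∘ σ)) = aeval (X ∘ σ) (SVinsert c (a ∘ σ)) by
      rw [← aeval_rename, aeval_X_left_apply],
    aeval_SVinsert, key 0 X, key L a, SVCochain.aeval_comp hc]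
  simp [SVinsert]

lemma SVinsert_SVpartial (a : ℂ) {q : ℕ} (c : SVRaw (q + 1)) :
    SVinsert (SVpartial a (q + 1) c) = SVpartial a q (SVinsert c) := by
  funext t
  simp [SVinsert, SVpartial, Fin.sum_univ_succ]

lemma SVskip_zero_succ {q : ℕ} (j : Fin (q + 1)) (k : Fin q) :
    SVskip 0 j.succ k = (j.succAbove k).succ := by
  rw [← Fin.succ_succAbove_succ]
  simp [SVskip]

lemma min_val_succ_eq_succ {q : ℕ} (i : Fin (q + 2)) :
    (⟨min (i.succ : ℕ) (q + 1), Nat.lt_succ_of_le (Nat.min_le_right _ _)⟩ : Fin (q + 2)) =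
      (⟨min (i : ℕ) q, Nat.lt_succ_of_le (Nat.min_le_right _ _)⟩ : Fin (q + 1)).succ := by
  simp

lemma SVskip_succ_succ_zero {q : ℕ} (i j : Fin (q + 2)) :
    SVskip i.succ j.succ (0 : Fin (q + 1)) = 0 := by
  rw [SVskip, min_val_succ_eq_succ, Fin.succAbove_ne_zero_zero (Fin.succ_ne_zero _),
    Fin.succAbove_ne_zero_zero (Fin.succ_ne_zero j)]

lemma SVskip_succ_succ_succ {q : ℕ} (i j : Fin (q + 2)) (k : Fin q) :
    SVskip i.succ j.succ k.succ = (SVskip i j k).succ := by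
  rw [SVskip, min_val_succ_eq_succ, Fin.succ_succAbove_succ, Fin.succ_succAbove_succ, SVskip]

lemma SVbrk_L (x : SVGen) : (SVbrk L x).1 = x ∧ (SVbrk L x).2.1 = 1 := by
  cases x <;> simp [SVbrk]

lemma aeval_SVdTerm_zero_succ {q : ℕ} {c : SVRaw (q + 1)} (hc : c ∈ SVCochain (q + 1))
    (a : Fin (q + 1) → SVGen) (j : Fin (q + 1)) :
    aeval (Fin.cons 0 X : Fin (q + 2) → MvPolynomial (Fin (q + 1)) ℂ)
        (SVdTerm c (Fin.cons L a) 0 j.succ) = X j * c a := by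
  have hf : (fun i => aeval (Fin.cons 0 X : Fin (q + 2) → MvPolynomial (Fin (q + 1)) ℂ)
      ((Fin.cons (X 0 + X j.succ) fun k => X (SVskip 0 j.succ k) :
        Fin (q + 1) → MvPolynomial (Fin (q + 2)) ℂ) i)) =
      Fin.cons (X j) fun k => X (j.succAbove k) := by
    funext i
    cases i using Fin.cases <;> simp [SVskip_zero_succ]
  rw [SVdTerm, map_smul, map_mul, ← AlgHom.comp_apply, comp_aeval, hf]
  simp only [Fin.cons_zero, Fin.cons_succ, SVskip_zero_succ, SVbrk_L]
  rw [SVCochain.aeval_cons_succAbove hc j a X]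
  have hs : (-1 : ℂ) ^ (j : ℕ) * (-1) ^ (j : ℕ) = 1 := by
    rw [← mul_pow]; simp
  simp [pow_succ, smul_smul, hs]

lemma aeval_SVdTerm_succ_succ {q : ℕ} {c : SVRaw (q + 2)} (hc : c ∈ SVCochain (q + 2))
    (a : Fin (q + 2) → SVGen) (i j : Fin (q + 2)) :
    aeval (Fin.cons 0 X : Fin (q + 3) → MvPolynomial (Fin (q + 2)) ℂ)
        (SVdTerm c (Fin.cons L a) i.succ j.succ) = -SVdTerm (SVinsert c) a i j := by
  have hf : (fun m => aeval (Fin.cons 0 X : Fin (q + 3) → MvPolynomial (Fin (q + 2)) ℂ)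
      ((Fin.cons (X i.succ + X j.succ) fun k => X (SVskip i.succ j.succ k) :
        Fin (q + 2) → MvPolynomial (Fin (q + 3)) ℂ) m)) =
      Fin.cons (X i + X j) (Fin.cons 0 fun k => X (SVskip i j k)) := by
    funext m
    cases m using Fin.cases with
    | zero => simp
    | succ m =>
      cases m using Fin.cases <;> simp [SVskip_succ_succ_zero, SVskip_succ_succ_succ]
  have ha : (fun k => (Fin.cons L a : Fin (q + 3) → SVGen) (SVskip i.succ j.succ k)) =
      Fin.cons L fun k => a (SVskip i j k) := by
    funext m
    cases m using Fin.cases <;> simp [SVskip_succ_succ_zero, SVskip_succ_succ_succ]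
  rw [SVdTerm, map_smul, map_mul, ← AlgHom.comp_apply, comp_aeval, hf, ha,
    SVCochain.aeval_cons_cons hc, SVdTerm, aeval_SVinsert]
  have hs : (-1 : ℂ) ^ ((i : ℕ) + 1 + ((j : ℕ) + 1)) = (-1) ^ ((i : ℕ) + (j : ℕ)) := by
    ring
  simp [hs]

/-- Insertion of `L` at `λ = 0` is a homotopy between `0` and multiplication by `∑ λᵢ`. -/
lemma SVinsert_SVd_add {q : ℕ} {c : SVRaw (q + 1)} (hc : c ∈ SVCochain (q + 1)) :
    SVinsert (SVd c) + SVd (SVinsert c) = SVpartial 0 (q + 1) c := by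
  funext a
  have h0 : SVinsert (SVd c) a = (∑ j, X j) * c a +
      ∑ i : Fin (q + 1), ∑ j : Fin (q + 1), if (i : ℕ) < (j : ℕ) then
        aeval (Fin.cons 0 X : Fin (q + 2) → MvPolynomial (Fin (q + 1)) ℂ)
          (SVdTerm c (Fin.cons L a) i.succ j.succ) else 0 := by
    simp only [SVinsert, SVd, map_sum]
    rw [Fin.sum_univ_succ, Fin.sum_univ_succ, Finset.sum_mul]
    congr 1
    · simp only [Fin.val_zero, Fin.val_succ, lt_irrefl, Nat.zero_lt_succ, if_true, if_false,
        map_zero, zero_add, aeval_SVdTerm_zero_succ hc]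
    · refine Finset.sum_congr rfl fun i _ => ?_
      rw [Fin.sum_univ_succ]
      simp [apply_ite]
  cases q with
  | zero =>
    rw [Pi.add_apply, h0]
    simp [SVd, SVpartial]
  | succ q =>
    simp only [Pi.add_apply, h0, aeval_SVdTerm_succ_succ hc]
    simp only [SVd, SVpartial, LinearMap.coe_mk, AddHom.coe_mk, map_zero, zero_add]
    refine (add_assoc _ _ _).trans ?_
    rw [← Finset.sum_add_distrib, add_eq_left]
    refine Finset.sum_eq_zero fun i _ => ?_
    rw [← Finset.sum_add_distrib]
    refine Finset.sum_eq_zero fun j _ => ?_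
    split_ifs <;> simp

lemma SVpartial_eq (a : ℂ) {q : ℕ} (c : SVRaw q) :
    SVpartial a q c = a • c + SVpartial 0 q c := by
  funext t
  simp [SVpartial, add_mul, C_mul']

lemma SVredCocycles_le (a : ℂ) (ha : a ≠ 0) (q : ℕ) :
    SVredCocycles a q ≤ SVredCoboundaries a q := by
  rintro c ⟨hc, e, he, hec⟩
  cases q with
  | zero =>
    refine ⟨a⁻¹ • c, Submodule.smul_mem _ _ hc, ?_⟩
    funext t
    simp [SVpartial, C_mul', ha]
  | succ q =>
    have h : a • c = SVpartial a (q + 1) (c - SVinsert e) - SVdLin q (SVinsert c) := by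
      have h1 := SVinsert_SVd_add hc
      rw [show SVd c = SVpartial a (q + 2) e from hec.symm, SVinsert_SVpartial] at h1
      rw [map_sub, SVpartial_eq a c, ← h1, show SVdLin q (SVinsert c) = SVd (SVinsert c) from rfl]
      abel
    rw [← inv_smul_smul₀ ha c, h]
    exact Submodule.smul_mem _ _ (Submodule.sub_mem _
      (Submodule.mem_sup_left ⟨_, Submodule.sub_mem _ hc (SVinsert_mem he), rfl⟩)
      (Submodule.mem_sup_right ⟨_, SVinsert_mem hc, rfl⟩))

/-- For `a ≠ 0`, the reduced cohomology of `SV` with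
coefficients in the trivial module `ℂ_a` vanishes in every degree:
every reduced cocycle is a reduced coboundary. -/
theorem statement16 (a : ℂ) (ha : a ≠ 0) (q : ℕ) :
    SVredCocycles a q ≤ SVredCoboundaries a q ∧ Subsingleton (SVredH a q) := by
  refine ⟨SVredCocycles_le a ha q, ?_⟩
  unfold SVredH
  rw [Submodule.Quotient.subsingleton_iff, Submodule.comap_subtype_eq_top]
  exact SVredCocycles_le a ha q

end SVCA
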